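/- For every natural number n ≥ 1, the n-th power of the system matrix applied to the initial vector satisfies L^n m₀ = Ẑ (C^{n−1} f₀). -/

import Mathlib

open Matrix BigOperators

/-- The connection matrix `L_k` associated to a face between cells `j₁` and `j₂`,
with nonnegative coefficients `a`, `b`. -/
noncomputable def connMat {J : ℕ} (j₁ j₂ : Fin J) (a b : ℝ) : Matrix (Fin J) (Fin J) ℝ :=
  Matrix.of fun i j =>
    if i = j₁ ∧ j = j₁ then -a
    else if i = j₁ ∧ j = j₂ then b
    else if i = j₂ ∧ j = j₁ then a
    else if i = j₂ ∧ j = j₂ then -b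
    else 0

/-- The direction vector `ẑ_k` associated to a face between cells `j₁` and `j₂`. -/
noncomputable def dirVec {J : ℕ} (j₁ j₂ : Fin J) : Fin J → ℝ :=
  fun j => if j = j₁ then 1 else if j = j₂ then -1 else 0

/-- The matrix `Ẑ` whose `k`-th column is the direction vector `ẑ_k`. -/
noncomputable def ZhatMat {J K : ℕ} (j₁ j₂ : Fin K → Fin J) : Matrix (Fin J) (Fin K) ℝ :=
  Matrix.of fun j k => dirVec (j₁ k) (j₂ k) j

/-- The coefficient matrix `C` with entries `C_{i,l} = b_i (ẑ_l)_{j₂ i} - a_i (ẑ_l)_{j₁ i}`,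
so that `L_i ẑ_l = C_{i,l} • ẑ_i`. -/
noncomputable def coeffMat {J K : ℕ} (j₁ j₂ : Fin K → Fin J) (a b : Fin K → ℝ) :
    Matrix (Fin K) (Fin K) ℝ :=
  Matrix.of fun i l => b i * dirVec (j₁ l) (j₂ l) (j₂ i) - a i * dirVec (j₁ l) (j₂ l) (j₁ i)

/-- The flux vector `f₀` with entries `(f₀)_k = b_k (m₀)_{j₂ k} - a_k (m₀)_{j₁ k}`,
so that `L_k m₀ = (f₀)_k • ẑ_k`. -/
noncomputable def fluxVec {J K : ℕ} (j₁ j₂ : Fin K → Fin J) (a b : Fin K → ℝ)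
    (m₀ : Fin J → ℝ) : Fin K → ℝ :=
  fun k => b k * m₀ (j₂ k) - a k * m₀ (j₁ k)

theorem connMat_mulVec {J : ℕ} {j₁ j₂ : Fin J} (hne : j₁ ≠ j₂) (a b : ℝ) (v : Fin J → ℝ) :
    connMat j₁ j₂ a b *ᵥ v = (b * v j₂ - a * v j₁) • dirVec j₁ j₂ := by
  have hrow : ∀ i j, connMat j₁ j₂ a b i j
      = dirVec j₁ j₂ i * ((if j = j₂ then b else 0) - (if j = j₁ then a else 0)) := by
    intro i j
    simp only [connMat, dirVec, Matrix.of_apply]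
    grind
  ext i
  simp only [Matrix.mulVec, dotProduct, hrow, mul_assoc, ← Finset.mul_sum, sub_mul,
    Finset.sum_sub_distrib, ite_mul, zero_mul, Finset.sum_ite_eq',
    Finset.mem_univ, if_true, Pi.smul_apply, smul_eq_mul]
  ring

theorem sum_connMat_mulVec {J K : ℕ} {j₁ j₂ : Fin K → Fin J} (hne : ∀ k, j₁ k ≠ j₂ k)
    (a b : Fin K → ℝ) (v : Fin J → ℝ) :
    (∑ k, connMat (j₁ k) (j₂ k) (a k) (b k)) *ᵥ v
      = ZhatMat j₁ j₂ *ᵥ fluxVec j₁ j₂ a b v := by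
  rw [Matrix.sum_mulVec]
  ext i
  simp only [Finset.sum_apply, connMat_mulVec (hne _), Matrix.mulVec, dotProduct, ZhatMat,
    fluxVec, Matrix.of_apply, Pi.smul_apply, smul_eq_mul, mul_comm]

theorem fluxVec_ZhatMat_mulVec {J K : ℕ} (j₁ j₂ : Fin K → Fin J) (a b : Fin K → ℝ)
    (x : Fin K → ℝ) :
    fluxVec j₁ j₂ a b (ZhatMat j₁ j₂ *ᵥ x) = coeffMat j₁ j₂ a b *ᵥ x := by
  ext i
  simp only [fluxVec, coeffMat, ZhatMat, Matrix.mulVec, dotProduct, Matrix.of_apply,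
    Finset.mul_sum, sub_mul, Finset.sum_sub_distrib, mul_assoc]

/-- For every `n ≥ 1`, `L^n m₀ = Ẑ (C^(n-1) f₀)`. -/
theorem stmt7 (J K : ℕ) (hJ : 0 < J) (hK : 0 < K)
    (j₁ j₂ : Fin K → Fin J) (hne : ∀ k, j₁ k ≠ j₂ k)
    (a b : Fin K → ℝ) (ha : ∀ k, 0 ≤ a k) (hb : ∀ k, 0 ≤ b k)
    (L : Matrix (Fin J) (Fin J) ℝ)
    (hL : L = ∑ k : Fin K, connMat (j₁ k) (j₂ k) (a k) (b k))
    (m₀ : Fin J → ℝ) (n : ℕ) (hn : 1 ≤ n) :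
    (L ^ n).mulVec m₀
      = (ZhatMat j₁ j₂).mulVec
          (((coeffMat j₁ j₂ a b) ^ (n - 1)).mulVec (fluxVec j₁ j₂ a b m₀)) := by
  obtain ⟨m, rfl⟩ := Nat.exists_eq_add_of_le' hn
  rw [Nat.add_sub_cancel]
  induction m with
  | zero => simp [hL, sum_connMat_mulVec hne]
  | succ m ih =>
    rw [pow_succ', ← Matrix.mulVec_mulVec, ih (Nat.le_add_left 1 m), hL,
      sum_connMat_mulVec hne, fluxVec_ZhatMat_mulVec, Matrix.mulVec_mulVec _ (coeffMat _ _ _ _),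
      ← pow_succ']
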